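/- Fix a field k, q ∈ k, and n ≥ 2. Define linear operators T₁,…,T_n on k^{n+1} with standard basis e₁,…,e_{n+1} by T_i(e_j) = e_j − (q·δ_{i,j} − δ_{i+1,j})·(q·e_i − e_{i+1}). Then the T_i satisfy the braid relations: T_i T_j = T_j T_i whenever |i−j| > 1, and T_i T_{i+1} T_i = T_{i+1} T_i T_{i+1} for 1 ≤ i ≤ n−1. Moreover T_i² = (1−q²)·T_i + q²·id for every i. -/

import Mathlib

/-- The modified Burau matrix `T_i` on `k^{n+1}`: the matrix of the operator
`T_i(e_j) = e_j − (q·δ_{i,j} − δ_{i+1,j})·(q·e_i − e_{i+1})`, with the paper's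
index `i ∈ {1,…,n}` represented by `i : Fin n` (paper `i` ↦ `i.castSucc`,
paper `i+1` ↦ `i.succ`). -/
def burau (k : Type*) [Field k] (q : k) (n : ℕ) (i : Fin n) :
    Matrix (Fin (n + 1)) (Fin (n + 1)) k :=
  Matrix.of fun s j =>
    (if s = j then (1 : k) else 0) -
      (q * (if j = i.castSucc then 1 else 0) - (if j = i.succ then 1 else 0)) *
      (q * (if s = i.castSucc then 1 else 0) - (if s = i.succ then 1 else 0))

/-- The vector `q e_i - e_{i+1}`. -/
def bvec (k : Type*) [Field k] (q : k) (n : ℕ) (i : Fin n) : Fin (n + 1) → k :=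
  q • Pi.single i.castSucc 1 - Pi.single i.succ 1

/-- The rank one matrix `v_i v_iᵀ`. -/
def bproj (k : Type*) [Field k] (q : k) (n : ℕ) (i : Fin n) :
    Matrix (Fin (n + 1)) (Fin (n + 1)) k :=
  Matrix.vecMulVec (bvec k q n i) (bvec k q n i)

theorem burau_eq (k : Type*) [Field k] (q : k) (n : ℕ) (i : Fin n) :
    burau k q n i = 1 - bproj k q n i := by
  ext s j
  simp only [burau, bproj, bvec, Matrix.of_apply, Matrix.sub_apply, Matrix.one_apply,
    Matrix.vecMulVec_apply, Pi.sub_apply, Pi.smul_apply, Pi.single_apply, smul_eq_mul]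
  ring

theorem bproj_mul (k : Type*) [Field k] (q : k) (n : ℕ) (i j : Fin n) :
    bproj k q n i * bproj k q n j =
      (bvec k q n i ⬝ᵥ bvec k q n j) • Matrix.vecMulVec (bvec k q n i) (bvec k q n j) := by
  ext s t
  simp [bproj, Matrix.vecMulVec_mul_vecMulVec, Matrix.vecMulVec_apply]
  try ring

theorem bproj_mul3 (k : Type*) [Field k] (q : k) (n : ℕ) (i j : Fin n) :
    bproj k q n i * bproj k q n j * bproj k q n i =
      ((bvec k q n i ⬝ᵥ bvec k q n j) * (bvec k q n j ⬝ᵥ bvec k q n i)) • bproj k q n i := by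
  rw [bproj_mul]
  ext s t
  simp [bproj, Matrix.vecMulVec_mul_vecMulVec, Matrix.vecMulVec_apply]
  try ring

theorem bvec_dot (k : Type*) [Field k] (q : k) (n : ℕ) (i j : Fin n) :
    bvec k q n i ⬝ᵥ bvec k q n j =
      q * (q * (if (i : ℕ) = j then 1 else 0) - (if (i : ℕ) = j + 1 then 1 else 0))
       - (q * (if (i : ℕ) + 1 = j then 1 else 0) - (if (i : ℕ) = j then 1 else 0)) := by
  rw [dotProduct_comm]
  simp [bvec, Pi.single_apply, Fin.ext_iff]

theorem stmt_6 (k : Type*) [Field k] (q : k) (n : ℕ) (hn : 2 ≤ n) :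
    (∀ i j : Fin n, ((i : ℕ) + 1 < (j : ℕ) ∨ (j : ℕ) + 1 < (i : ℕ)) →
        burau k q n i * burau k q n j = burau k q n j * burau k q n i) ∧
    (∀ i j : Fin n, (j : ℕ) = (i : ℕ) + 1 →
        burau k q n i * burau k q n j * burau k q n i =
          burau k q n j * burau k q n i * burau k q n j) ∧
    (∀ i : Fin n, burau k q n i ^ 2 =
        (1 - q ^ 2) • burau k q n i +
          q ^ 2 • (1 : Matrix (Fin (n + 1)) (Fin (n + 1)) k)) := by
  have hsq : ∀ i : Fin n, bproj k q n i * bproj k q n i = (1 + q ^ 2) • bproj k q n i := by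
    intro i
    rw [bproj_mul, bvec_dot]
    simp only [bproj]
    congr 1
    simp
    ring
  refine ⟨?_, ?_, ?_⟩
  · intro i j h
    have h0 : ∀ a b : Fin n, ((a : ℕ) + 1 < (b : ℕ) ∨ (b : ℕ) + 1 < (a : ℕ)) →
        bproj k q n a * bproj k q n b = 0 := by
      intro a b hab
      rw [bproj_mul, bvec_dot, if_neg (by omega), if_neg (by omega), if_neg (by omega)]
      simp
    have h1 := h0 i j h
    have h2 := h0 j i h.symm
    rw [burau_eq, burau_eq]
    simp only [sub_mul, mul_sub, one_mul, mul_one, h1, h2]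
    abel
  · intro i j h
    have hd : bvec k q n i ⬝ᵥ bvec k q n j = -q := by
      rw [bvec_dot, if_neg (by omega), if_neg (by omega), if_pos (by omega)]
      ring
    have hd' : bvec k q n j ⬝ᵥ bvec k q n i = -q := by
      rw [dotProduct_comm, hd]
    have h1 := bproj_mul3 k q n i j
    have h2 := bproj_mul3 k q n j i
    rw [hd, hd'] at h1 h2
    rw [burau_eq, burau_eq]
    simp only [sub_mul, mul_sub, one_mul, mul_one, h1, h2, hsq]
    module
  · intro i
    rw [burau_eq, pow_two]
    simp only [sub_mul, mul_sub, one_mul, mul_one, hsq]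
    module
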